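/- Let f : [0,1] → [0,1] be a continuous, strictly increasing bijection with f(0) = 0 and f(1) = 1, and let η : [0,1] → ℝʳ be a continuous function satisfying η(f(t)) = η(t) for all t ∈ [0,1]. If η is not constant on any nonempty open subinterval of [0,1], then f(t) = t for all t ∈ [0,1]. -/

import Mathlib

theorem MonotoneOn.iterate {α : Type*} [Preorder α] {f : α → α} {s : Set α}
    (hf : MonotoneOn f s) (hmaps : Set.MapsTo f s s) (n : ℕ) : MonotoneOn f^[n] s := by
  induction n with
  | zero => exact monotoneOn_id
  | succ n ih => exact ih.comp hf hmaps

open Filter Topology in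
/-- The orbits of a monotone self-map of a compact real interval converge in the interval. -/
theorem MonotoneOn.exists_tendsto_iterate {f : ℝ → ℝ} {a b : ℝ}
    (hf : MonotoneOn f (Set.Icc a b)) (hmaps : Set.MapsTo f (Set.Icc a b) (Set.Icc a b))
    {t : ℝ} (ht : t ∈ Set.Icc a b) :
    ∃ L ∈ Set.Icc a b, Tendsto (fun n => f^[n] t) atTop (𝓝 L) := by
  have hmem : ∀ n, f^[n] t ∈ Set.Icc a b := fun n => hmaps.iterate n ht
  have hlim : ∃ L, Tendsto (fun n => f^[n] t) atTop (𝓝 L) := by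
    rcases le_total t (f t) with h | h
    · have hmono : Monotone fun n => f^[n] t := by
        refine monotone_nat_of_le_succ fun n => ?_
        rw [Function.iterate_succ_apply]
        exact hf.iterate hmaps n ht (hmaps ht) h
      exact ⟨_, tendsto_atTop_ciSup hmono ⟨b, Set.forall_mem_range.2 fun n => (hmem n).2⟩⟩
    · have hanti : Antitone fun n => f^[n] t := by
        refine antitone_nat_of_succ_le fun n => ?_
        rw [Function.iterate_succ_apply]
        exact hf.iterate hmaps n (hmaps ht) ht h
      exact ⟨_, tendsto_atTop_ciInf hanti ⟨a, Set.forall_mem_range.2 fun n => (hmem n).1⟩⟩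
  obtain ⟨L, hL⟩ := hlim
  exact ⟨L, isClosed_Icc.mem_of_tendsto hL (Eventually.of_forall hmem), hL⟩

open Filter Topology in
/-- A continuous function invariant under a monotone self-map `f` of a compact real interval
is constant between any point and its image under `f`. -/
theorem MonotoneOn.exists_eq_on_uIcc_of_invariant {E : Type*} [TopologicalSpace E] [T2Space E]
    {f : ℝ → ℝ} {a b : ℝ} (hf : MonotoneOn f (Set.Icc a b))
    (hmaps : Set.MapsTo f (Set.Icc a b) (Set.Icc a b)) {η : ℝ → E}
    (hη : ContinuousOn η (Set.Icc a b)) (hinv : ∀ t ∈ Set.Icc a b, η (f t) = η t)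
    {t : ℝ} (ht : t ∈ Set.Icc a b) :
    ∃ c, ∀ x ∈ Set.uIcc t (f t), η x = c := by
  obtain ⟨L, hL, hlim⟩ := hf.exists_tendsto_iterate hmaps ht
  refine ⟨η L, fun x hx => ?_⟩
  have hxI : x ∈ Set.Icc a b := Set.uIcc_subset_Icc ht (hmaps ht) hx
  have hmem : ∀ n, f^[n] x ∈ Set.Icc a b := fun n => hmaps.iterate n hxI
  have hlim' : Tendsto (fun n => f^[n] (f t)) atTop (𝓝 L) := by
    exact hlim.comp (tendsto_add_atTop_nat 1)
  have hxlim : Tendsto (fun n => f^[n] x) atTop (𝓝 L) := by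
    rcases Set.mem_uIcc.1 hx with h | h
    · exact tendsto_of_tendsto_of_tendsto_of_le_of_le hlim hlim'
        (fun n => hf.iterate hmaps n ht hxI h.1)
        (fun n => hf.iterate hmaps n hxI (hmaps ht) h.2)
    · exact tendsto_of_tendsto_of_tendsto_of_le_of_le hlim' hlim
        (fun n => hf.iterate hmaps n (hmaps ht) hxI h.1)
        (fun n => hf.iterate hmaps n hxI ht h.2)
  have hconst : ∀ n, η (f^[n] x) = η x := by
    intro n
    induction n with
    | zero => rfl
    | succ n ih => rw [Function.iterate_succ_apply', hinv _ (hmem n), ih]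
  have hηlim : Tendsto (fun n => η (f^[n] x)) atTop (𝓝 (η L)) :=
    (hη L hL).tendsto.comp (tendsto_nhdsWithin_iff.2 ⟨hxlim, Eventually.of_forall hmem⟩)
  simp only [hconst] at hηlim
  exact tendsto_nhds_unique tendsto_const_nhds hηlim


/-- If `f : [0,1] → [0,1]` is a continuous strictly increasing bijection fixing `0` and `1`,
and the continuous curve `η : [0,1] → ℝʳ` satisfies `η ∘ f = η` and is not constant on any
nonempty open subinterval, then `f` is the identity on `[0,1]`. -/
theorem warping_fixed_by_nonconstant_curve {r : ℕ} (f : ℝ → ℝ)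
    (hc : ContinuousOn f (Set.Icc 0 1)) (hm : StrictMonoOn f (Set.Icc 0 1))
    (hbij : Set.BijOn f (Set.Icc 0 1) (Set.Icc 0 1))
    (hf0 : f 0 = 0) (hf1 : f 1 = 1)
    (η : ℝ → Fin r → ℝ) (hηc : ContinuousOn η (Set.Icc 0 1))
    (hinv : ∀ t ∈ Set.Icc (0:ℝ) 1, η (f t) = η t)
    (hnc : ∀ a b : ℝ, 0 ≤ a → a < b → b ≤ 1 →
      ∃ s ∈ Set.Ioo a b, ∃ u ∈ Set.Ioo a b, η s ≠ η u) :
    ∀ t ∈ Set.Icc (0:ℝ) 1, f t = t := by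
  intro t ht
  by_contra hne
  obtain ⟨c, hconst⟩ :=
    hm.monotoneOn.exists_eq_on_uIcc_of_invariant hbij.mapsTo hηc hinv ht
  have hft := hbij.mapsTo ht
  obtain ⟨s, hs, u, hu, hsu⟩ := hnc (min t (f t)) (max t (f t)) (le_min ht.1 hft.1)
    (min_lt_max.2 (Ne.symm hne)) (max_le ht.2 hft.2)
  exact hsu ((hconst s (Set.Ioo_subset_Icc_self hs)).trans
    (hconst u (Set.Ioo_subset_Icc_self hu)).symm)
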